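/- Let p ∈ (0,∞], q ∈ [1,∞] and let b be slowly varying. Then ‖·‖_{(p,q,b)} is a rearrangement-invariant Banach function norm (and consequently L^{(p,q,b)} is an r.i. Banach function space) if and only if one of the following conditions holds: (1) p ∈ (1,∞); (2) p = 1 and ‖ t^{−1/q} b(t) χ_{(1,∞)}(t) ‖_{L^q(0,∞)} < ∞; (3) p = ∞ and ‖ t^{−1/q} b(t) χ_{(0,1)}(t) ‖_{L^q(0,∞)} < ∞. Furthermore, if none of these conditions is satisfied, then L^{(p,q,b)} = {0}. -/

import Mathlib

open MeasureTheory Set Filter ENNReal Topology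

noncomputable section

/-- `f ≈ g` on `S`: two-sided equivalence with positive constants. -/
def EquivOn (f g : ℝ → ℝ) (S : Set ℝ) : Prop :=
  ∃ c C : ℝ, 0 < c ∧ 0 < C ∧ ∀ t ∈ S, c * g t ≤ f t ∧ f t ≤ C * g t

/-- A measurable positive function on `(0,∞)` is slowly varying if for every `ε > 0`,
`t ^ ε * b t` is equivalent to a non-decreasing function and `t ^ (-ε) * b t` is
equivalent to a non-increasing function on `(0,∞)`. -/
def IsSlowlyVarying (b : ℝ → ℝ) : Prop :=
  Measurable b ∧ (∀ t ∈ Set.Ioi (0:ℝ), 0 < b t) ∧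
    ∀ ε : ℝ, 0 < ε →
      (∃ bp : ℝ → ℝ, MonotoneOn bp (Set.Ioi 0) ∧
        EquivOn (fun t => t ^ ε * b t) bp (Set.Ioi 0)) ∧
      (∃ bm : ℝ → ℝ, AntitoneOn bm (Set.Ioi 0) ∧
        EquivOn (fun t => t ^ (-ε) * b t) bm (Set.Ioi 0))

/-- The non-increasing rearrangement `f*` (with values in `ℝ≥0∞`). -/
def rearr {X : Type*} [MeasurableSpace X] (μ : Measure X) (f : X → ℝ) (t : ℝ) : ℝ≥0∞ :=
  sInf {s : ℝ≥0∞ | μ {x | s < ENNReal.ofReal |f x|} ≤ ENNReal.ofReal t}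

/-- The maximal function `f**(t) = (1/t) ∫₀ᵗ f*`. -/
def maxf {X : Type*} [MeasurableSpace X] (μ : Measure X) (f : X → ℝ) (t : ℝ) : ℝ≥0∞ :=
  (ENNReal.ofReal t)⁻¹ * ∫⁻ s in Set.Ioo (0:ℝ) t, rearr μ f s

/-- The `L^q` "norm" over a subset `S ⊆ ℝ` of an `ℝ≥0∞`-valued function. -/
def lqNorm (q : ℝ≥0∞) (S : Set ℝ) (g : ℝ → ℝ≥0∞) : ℝ≥0∞ :=
  if q = ∞ then essSup g (volume.restrict S)
  else (∫⁻ t in S, g t ^ q.toReal) ^ (1 / q.toReal)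

/-- The Lorentz–Karamata functional `‖f‖_{p,q,b}`. -/
def lkNorm {X : Type*} [MeasurableSpace X] (μ : Measure X) (p q : ℝ≥0∞) (b : ℝ → ℝ)
    (f : X → ℝ) : ℝ≥0∞ :=
  lqNorm q (Set.Ioi 0)
    (fun t => ENNReal.ofReal (t ^ (p⁻¹.toReal - q⁻¹.toReal) * b t) * rearr μ f t)

/-- The Lorentz–Karamata functional `‖f‖_{(p,q,b)}` defined via the maximal function. -/
def lkMaxNorm {X : Type*} [MeasurableSpace X] (μ : Measure X) (p q : ℝ≥0∞) (b : ℝ → ℝ)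
    (f : X → ℝ) : ℝ≥0∞ :=
  lqNorm q (Set.Ioi 0)
    (fun t => ENNReal.ofReal (t ^ (p⁻¹.toReal - q⁻¹.toReal) * b t) * maxf μ f t)

/-- The `L^q(0,∞)` norm of `t ^ (1/p - 1/q) * b t` restricted to `S`. -/
def weightNorm (p q : ℝ≥0∞) (b : ℝ → ℝ) (S : Set ℝ) : ℝ≥0∞ :=
  lqNorm q S (fun t => ENNReal.ofReal (t ^ (p⁻¹.toReal - q⁻¹.toReal) * b t))

/-- A measure is non-atomic. -/
def IsNonatomic {X : Type*} [MeasurableSpace X] (μ : Measure X) : Prop :=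
  ∀ s : Set X, MeasurableSet s → 0 < μ s →
    ∃ t, t ⊆ s ∧ MeasurableSet t ∧ 0 < μ t ∧ μ t < μ s

/-- `b̃(t) = ∫₀ᵗ s⁻¹ b(s) ds`. -/
def svTilde (b : ℝ → ℝ) (t : ℝ) : ℝ≥0∞ :=
  ∫⁻ s in Set.Ioo (0:ℝ) t, ENNReal.ofReal (s⁻¹ * b s)

/-- `b̃_∞(t) = esssup_{s ∈ (0,t)} b(s)`. -/
def svTildeSup (b : ℝ → ℝ) (t : ℝ) : ℝ≥0∞ :=
  essSup (fun s => ENNReal.ofReal (b s)) (volume.restrict (Set.Ioo (0:ℝ) t))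

/-- `b̂(t) = ∫_t^∞ s⁻¹ b(s) ds`. -/
def svHat (b : ℝ → ℝ) (t : ℝ) : ℝ≥0∞ :=
  ∫⁻ s in Set.Ioi t, ENNReal.ofReal (s⁻¹ * b s)

/-- `b̂_∞(t) = esssup_{s ∈ (t,∞)} b(s)`. -/
def svHatSup (b : ℝ → ℝ) (t : ℝ) : ℝ≥0∞ :=
  essSup (fun s => ENNReal.ofReal (b s)) (volume.restrict (Set.Ioi t))

/-- The associate functional of a functional `N`. -/
def assocNorm {X : Type*} [MeasurableSpace X] (μ : Measure X) (N : (X → ℝ) → ℝ≥0∞)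
    (f : X → ℝ) : ℝ≥0∞ :=
  ⨆ (g : X → ℝ) (_ : Measurable g) (_ : N g ≤ 1), ∫⁻ x, ENNReal.ofReal |f x * g x| ∂μ

/-- The conjugate exponent: `q' = q/(q-1)` for `q ∈ (1,∞)`, `1' = ∞`, `∞' = 1`. -/
def conjE (q : ℝ≥0∞) : ℝ≥0∞ := (1 - q⁻¹)⁻¹

/-- The interval `(0, μ(R))` inside `ℝ`, where `μ(R)` may be infinite. -/
def IooMu {X : Type*} [MeasurableSpace X] (μ : Measure X) : Set ℝ :=
  {t : ℝ | 0 < t ∧ ENNReal.ofReal t < μ Set.univ}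

/-- The embedding `L^{p₁,q₁,b₁} ↪ L^{p₂,q₂,b₂}`. -/
def lkEmbed {X : Type*} [MeasurableSpace X] (μ : Measure X) (p1 q1 : ℝ≥0∞) (b1 : ℝ → ℝ)
    (p2 q2 : ℝ≥0∞) (b2 : ℝ → ℝ) : Prop :=
  ∃ C : ℝ≥0∞, C < ∞ ∧ ∀ f : X → ℝ, Measurable f →
    lkNorm μ p2 q2 b2 f ≤ C * lkNorm μ p1 q1 b1 f

/-- A rearrangement-invariant quasi-Banach function norm. -/
structure IsRIQuasiBFN {X : Type*} [MeasurableSpace X] (μ : Measure X)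
    (N : (X → ℝ) → ℝ≥0∞) : Prop where
  abs_eq : ∀ f : X → ℝ, Measurable f → N (fun x => |f x|) = N f
  smul : ∀ (a : ℝ) (f : X → ℝ), Measurable f →
    N (fun x => a * f x) = ENNReal.ofReal |a| * N f
  eq_zero_iff : ∀ f : X → ℝ, Measurable f → (N f = 0 ↔ f =ᵐ[μ] 0)
  quasi_add : ∃ C : ℝ≥0∞, C < ∞ ∧ ∀ f g : X → ℝ, Measurable f → Measurable g →
    N (fun x => f x + g x) ≤ C * (N f + N g)
  mono : ∀ f g : X → ℝ, Measurable f → Measurable g →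
    (∀ᵐ x ∂μ, |f x| ≤ |g x|) → N f ≤ N g
  fatou : ∀ (f : ℕ → X → ℝ) (g : X → ℝ), (∀ n, Measurable (f n)) → Measurable g →
    (∀ᵐ x ∂μ, ∀ n, 0 ≤ f n x) → (∀ᵐ x ∂μ, Monotone fun n => f n x) →
    (∀ᵐ x ∂μ, Filter.Tendsto (fun n => f n x) Filter.atTop (nhds (g x))) →
    N g = ⨆ n, N (f n)
  ind_lt_top : ∀ E : Set X, MeasurableSet E → μ E < ∞ →
    N (Set.indicator E fun _ => (1:ℝ)) < ∞
  rearr_inv : ∀ f g : X → ℝ, Measurable f → Measurable g →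
    rearr μ f = rearr μ g → N f = N g

/-- A rearrangement-invariant Banach function norm. -/
structure IsRIBFN {X : Type*} [MeasurableSpace X] (μ : Measure X)
    (N : (X → ℝ) → ℝ≥0∞) : Prop where
  abs_eq : ∀ f : X → ℝ, Measurable f → N (fun x => |f x|) = N f
  smul : ∀ (a : ℝ) (f : X → ℝ), Measurable f →
    N (fun x => a * f x) = ENNReal.ofReal |a| * N f
  eq_zero_iff : ∀ f : X → ℝ, Measurable f → (N f = 0 ↔ f =ᵐ[μ] 0)
  add_le : ∀ f g : X → ℝ, Measurable f → Measurable g →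
    N (fun x => f x + g x) ≤ N f + N g
  mono : ∀ f g : X → ℝ, Measurable f → Measurable g →
    (∀ᵐ x ∂μ, |f x| ≤ |g x|) → N f ≤ N g
  fatou : ∀ (f : ℕ → X → ℝ) (g : X → ℝ), (∀ n, Measurable (f n)) → Measurable g →
    (∀ᵐ x ∂μ, ∀ n, 0 ≤ f n x) → (∀ᵐ x ∂μ, Monotone fun n => f n x) →
    (∀ᵐ x ∂μ, Filter.Tendsto (fun n => f n x) Filter.atTop (nhds (g x))) →
    N g = ⨆ n, N (f n)
  ind_lt_top : ∀ E : Set X, MeasurableSet E → μ E < ∞ →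
    N (Set.indicator E fun _ => (1:ℝ)) < ∞
  integral_le : ∀ E : Set X, MeasurableSet E → μ E < ∞ →
    ∃ C : ℝ≥0∞, C < ∞ ∧ ∀ f : X → ℝ, Measurable f →
      ∫⁻ x in E, ENNReal.ofReal |f x| ∂μ ≤ C * N f
  rearr_inv : ∀ f g : X → ℝ, Measurable f → Measurable g →
    rearr μ f = rearr μ g → N f = N g

end

section LqNorm

variable {q : ℝ≥0∞} {S T : Set ℝ} {g h : ℝ → ℝ≥0∞}

lemma lqNorm_top : lqNorm ∞ S g = essSup g (volume.restrict S) := if_pos rfl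

lemma lqNorm_of_ne_top (hq : q ≠ ∞) :
    lqNorm q S g = (∫⁻ t in S, g t ^ q.toReal) ^ (1 / q.toReal) := if_neg hq

lemma one_le_toReal_of_one_le (hq : 1 ≤ q) (hq' : q ≠ ∞) : 1 ≤ q.toReal := by
  simpa using ENNReal.toReal_mono hq' hq

lemma lqNorm_congr_set (hST : S =ᵐ[volume] T) : lqNorm q S g = lqNorm q T g := by
  simp only [lqNorm, Measure.restrict_congr_set hST]

lemma lqNorm_mono (hS : MeasurableSet S) (hgh : ∀ t ∈ S, g t ≤ h t) :
    lqNorm q S g ≤ lqNorm q S h := by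
  have hae : ∀ᵐ t ∂volume.restrict S, g t ≤ h t := ae_restrict_of_forall_mem hS hgh
  unfold lqNorm
  split_ifs with hq
  · exact essSup_mono_ae hae
  · refine ENNReal.rpow_le_rpow (lintegral_mono_ae ?_) (by positivity)
    filter_upwards [hae] with t ht
    exact ENNReal.rpow_le_rpow ht toReal_nonneg

lemma lqNorm_mono_set (hST : S ⊆ T) : lqNorm q S g ≤ lqNorm q T g := by
  unfold lqNorm
  split_ifs with hq
  · exact essSup_mono_measure' (Measure.restrict_mono hST le_rfl)
  · exact ENNReal.rpow_le_rpow (lintegral_mono_set hST) (by positivity)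

lemma lqNorm_const_mul (hq : 1 ≤ q) (hg : Measurable g) (c : ℝ≥0∞) :
    lqNorm q S (fun t => c * g t) = c * lqNorm q S g := by
  by_cases hq' : q = ∞
  · subst hq'
    simp only [lqNorm_top, ENNReal.essSup_const_mul]
  · have h1 := one_le_toReal_of_one_le hq hq'
    have h0 : 0 < q.toReal := by linarith
    simp only [lqNorm_of_ne_top hq', ENNReal.mul_rpow_of_nonneg _ _ h0.le]
    rw [lintegral_const_mul _ (hg.pow_const _), ENNReal.mul_rpow_of_nonneg _ _ (by positivity),
      one_div, ENNReal.rpow_rpow_inv h0.ne']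

lemma lqNorm_add_le (hq : 1 ≤ q) (hg : Measurable g) (hh : Measurable h) :
    lqNorm q S (fun t => g t + h t) ≤ lqNorm q S g + lqNorm q S h := by
  by_cases hq' : q = ∞
  · subst hq'
    simp only [lqNorm_top]
    exact ENNReal.essSup_add_le g h
  · simp only [lqNorm_of_ne_top hq']
    exact ENNReal.lintegral_Lp_add_le hg.aemeasurable hh.aemeasurable
      (one_le_toReal_of_one_le hq hq')

lemma lqNorm_union_le (hq : 1 ≤ q) :
    lqNorm q (S ∪ T) g ≤ lqNorm q S g + lqNorm q T g := by
  by_cases hq' : q = ∞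
  · subst hq'
    simp only [lqNorm_top]
    refine essSup_le_of_ae_le _ ?_
    refine (ae_restrict_union_iff _ _ _).2 ⟨?_, ?_⟩
    · filter_upwards [ENNReal.ae_le_essSup g] with t ht using ht.trans le_self_add
    · filter_upwards [ENNReal.ae_le_essSup g] with t ht using ht.trans le_add_self
  · simp only [lqNorm_of_ne_top hq']
    have h1 := one_le_toReal_of_one_le hq hq'
    exact (ENNReal.rpow_le_rpow (lintegral_union_le _ _ _) (by positivity)).trans
      (ENNReal.rpow_add_le_add_rpow _ _ (by positivity)
        (by rw [div_le_one (by linarith)]; exact h1))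

lemma lqNorm_iSup (hq : 1 ≤ q) {G : ℕ → ℝ → ℝ≥0∞} (hG : ∀ n, Measurable (G n))
    (hmono : Monotone G) :
    lqNorm q S (fun t => ⨆ n, G n t) = ⨆ n, lqNorm q S (G n) := by
  by_cases hq' : q = ∞
  · subst hq'
    simp only [lqNorm_top]
    refine le_antisymm (essSup_le_of_ae_le _ ?_) (iSup_le fun n => essSup_mono_ae ?_)
    · have := ae_all_iff.2 fun n => ENNReal.ae_le_essSup (μ := volume.restrict S) (G n)
      filter_upwards [this] with t ht
      exact iSup_mono ht
    · exact Eventually.of_forall fun t => le_iSup (fun n => G n t) n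
  · have h1 := one_le_toReal_of_one_le hq hq'
    have h0 : 0 < q.toReal := by linarith
    simp only [lqNorm_of_ne_top hq']
    have e1 : ∀ t, (⨆ n, G n t) ^ q.toReal = ⨆ n, G n t ^ q.toReal := fun t =>
      (ENNReal.orderIsoRpow q.toReal h0).map_iSup _
    have e2 : ∀ u : ℕ → ℝ≥0∞, (⨆ n, u n) ^ (1 / q.toReal) = ⨆ n, u n ^ (1 / q.toReal) := fun u =>
      (ENNReal.orderIsoRpow (1 / q.toReal) (by positivity)).map_iSup _
    simp only [e1]
    rw [lintegral_iSup (fun n => (hG n).pow_const _), e2]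
    exact fun n m hnm t => ENNReal.rpow_le_rpow (hmono hnm t) h0.le

lemma lqNorm_eq_zero_iff (hq : 1 ≤ q) (hg : Measurable g) :
    lqNorm q S g = 0 ↔ ∀ᵐ t ∂volume.restrict S, g t = 0 := by
  by_cases hq' : q = ∞
  · subst hq'
    simp only [lqNorm_top, ENNReal.essSup_eq_zero_iff]
    rfl
  · have h1 := one_le_toReal_of_one_le hq hq'
    have h0 : 0 < q.toReal := by linarith
    rw [lqNorm_of_ne_top hq', ENNReal.rpow_eq_zero_iff_of_pos (by positivity),
      lintegral_eq_zero_iff (hg.pow_const _)]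
    refine eventually_congr (Eventually.of_forall fun t => ?_)
    simp [ENNReal.rpow_eq_zero_iff_of_pos h0]

end LqNorm

lemma volume_restrict_Ioi_ofReal_lt (a : ℝ≥0∞) :
    volume.restrict (Ioi (0:ℝ)) {s | ENNReal.ofReal s < a} = a := by
  rw [Measure.restrict_apply (measurableSet_lt ENNReal.measurable_ofReal measurable_const)]
  by_cases ha : a = ∞
  · subst ha
    simp
  · have : {s : ℝ | ENNReal.ofReal s < a} ∩ Ioi 0 = Ioo 0 a.toReal := by
      ext s
      simp only [mem_inter_iff, mem_ofPred_eq, mem_Ioi, mem_Ioo]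
      exact ⟨fun h => ⟨h.2, (ENNReal.ofReal_lt_iff_lt_toReal h.2.le ha).1 h.1⟩,
        fun h => ⟨(ENNReal.ofReal_lt_iff_lt_toReal h.1.le ha).2 h.2, h.1⟩⟩
    rw [this, Real.volume_Ioo, sub_zero, ENNReal.ofReal_toReal ha]

lemma lintegral_eq_lintegral_meas_ofReal_lt {Y : Type*} [MeasurableSpace Y] (ν : Measure Y)
    [SFinite ν] {F : Y → ℝ≥0∞} (hF : Measurable F) :
    ∫⁻ y, F y ∂ν = ∫⁻ s in Ioi (0:ℝ), ν {y | ENNReal.ofReal s < F y} := by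
  have hm : MeasurableSet {z : Y × ℝ | ENNReal.ofReal z.2 < F z.1} :=
    measurableSet_lt (ENNReal.measurable_ofReal.comp measurable_snd) (hF.comp measurable_fst)
  have h1 : ∀ y, F y = volume.restrict (Ioi (0:ℝ))
      (Prod.mk y ⁻¹' {z : Y × ℝ | ENNReal.ofReal z.2 < F z.1}) := fun y =>
    (volume_restrict_Ioi_ofReal_lt (F y)).symm
  calc ∫⁻ y, F y ∂ν = (ν.prod (volume.restrict (Ioi (0:ℝ))))
        {z : Y × ℝ | ENNReal.ofReal z.2 < F z.1} := by
        rw [Measure.prod_apply hm]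
        exact lintegral_congr h1
    _ = _ := by
        rw [Measure.prod_apply_symm hm]
        rfl

/-- Equimeasurable functions have the same integral of the excess over a level. -/
lemma lintegral_tsub_eq_of_equimeasurable {Y Z : Type*} [MeasurableSpace Y] [MeasurableSpace Z]
    (ν : Measure Y) (η : Measure Z) [SFinite ν] [SFinite η] {F : Y → ℝ≥0∞} {G : Z → ℝ≥0∞}
    (hF : Measurable F) (hG : Measurable G)
    (h : ∀ c, ν {y | c < F y} = η {z | c < G z}) (r : ℝ≥0∞) :
    ∫⁻ y, (F y - r) ∂ν = ∫⁻ z, (G z - r) ∂η := by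
  rw [lintegral_eq_lintegral_meas_ofReal_lt ν (hF.sub_const r),
    lintegral_eq_lintegral_meas_ofReal_lt η (hG.sub_const r)]
  simp only [lt_tsub_iff_right, h]

section Rearrangement

variable {X : Type*} [MeasurableSpace X] {μ : Measure X} {f g : X → ℝ}

lemma rearr_le_iff {t : ℝ} {c : ℝ≥0∞} :
    rearr μ f t ≤ c ↔ μ {x | c < ENNReal.ofReal |f x|} ≤ ENNReal.ofReal t := by
  refine ⟨fun h => ?_, fun h => sInf_le h⟩
  rcases eq_or_ne c ∞ with rfl | hc
  · simp
  obtain ⟨u, hu, humem, hlim⟩ := exists_seq_strictAnti_tendsto' (lt_top_iff_ne_top.2 hc)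
  have hmem : ∀ n, c < u n := fun n => (humem n).1
  have hset : {x | c < ENNReal.ofReal |f x|} = ⋃ n, {x | u n < ENNReal.ofReal |f x|} := by
    ext x
    simp only [mem_ofPred_eq, mem_iUnion]
    exact ⟨fun hx => (hlim.eventually_lt_const hx).exists, fun ⟨n, hn⟩ => (hmem n).trans hn⟩
  have hdir : Monotone fun n => {x | u n < ENNReal.ofReal |f x|} :=
    fun n m hnm x hx => (hu.antitone hnm).trans_lt hx
  rw [hset, hdir.measure_iUnion]
  refine iSup_le fun n => ?_
  obtain ⟨s, hs, hsn⟩ := sInf_lt_iff.1 (h.trans_lt (hmem n))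
  exact (measure_mono fun x hx => hsn.trans hx).trans hs

lemma lt_rearr_iff {t : ℝ} {c : ℝ≥0∞} :
    c < rearr μ f t ↔ ENNReal.ofReal t < μ {x | c < ENNReal.ofReal |f x|} := by
  simpa only [not_le] using (rearr_le_iff (μ := μ) (f := f) (t := t) (c := c)).not

lemma rearr_antitone : Antitone (rearr μ f) := fun _ _ hst =>
  rearr_le_iff.2 ((rearr_le_iff.1 le_rfl).trans (ENNReal.ofReal_le_ofReal hst))

lemma measurable_rearr : Measurable (rearr μ f) := rearr_antitone.measurable

lemma rearr_mono (h : ∀ᵐ x ∂μ, |f x| ≤ |g x|) (t : ℝ) : rearr μ f t ≤ rearr μ g t := by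
  refine rearr_le_iff.2 (le_trans (measure_mono_ae ?_) (rearr_le_iff (f := g).1 le_rfl))
  filter_upwards [h] with x hx hx'
  exact lt_of_lt_of_le hx' (ENNReal.ofReal_le_ofReal hx)

lemma rearr_const_mul (a : ℝ) (t : ℝ) :
    rearr μ (fun x => a * f x) t = ENNReal.ofReal |a| * rearr μ f t := by
  rcases eq_or_ne a 0 with rfl | ha
  · simp [rearr]
  have ha0 : ENNReal.ofReal |a| ≠ 0 := by simpa using ha
  have hat : ENNReal.ofReal |a| ≠ ∞ := ofReal_ne_top
  refine eq_of_forall_ge_iff fun c => ?_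
  rw [mul_comm, ← ENNReal.le_div_iff_mul_le (Or.inl ha0) (Or.inl hat), rearr_le_iff, rearr_le_iff]
  simp only [abs_mul, ENNReal.ofReal_mul (abs_nonneg _), mul_comm (ENNReal.ofReal |a|),
    ENNReal.div_lt_iff (Or.inl ha0) (Or.inl hat)]

lemma rearr_eq_iSup {F : ℕ → X → ℝ} (h0 : ∀ᵐ x ∂μ, ∀ n, 0 ≤ F n x)
    (hmono : ∀ᵐ x ∂μ, Monotone fun n => F n x)
    (hlim : ∀ᵐ x ∂μ, Tendsto (fun n => F n x) atTop (𝓝 (g x))) (t : ℝ) :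
    rearr μ g t = ⨆ n, rearr μ (F n) t := by
  refine le_antisymm (rearr_le_iff.2 ?_) (iSup_le fun n => rearr_mono ?_ t)
  · set c := ⨆ n, rearr μ (F n) t
    have hn : ∀ n, μ {x | c < ENNReal.ofReal |F n x|} ≤ ENNReal.ofReal t := fun n =>
      rearr_le_iff.1 (le_iSup (fun n => rearr μ (F n) t) n)
    have hle : μ {x | c < ENNReal.ofReal |g x|} ≤
        μ (⋃ n, ⋂ m ≥ n, {x | c < ENNReal.ofReal |F m x|}) := by
      refine measure_mono_ae ?_
      filter_upwards [hlim] with x hx hcx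
      have : Tendsto (fun n => ENNReal.ofReal |F n x|) atTop (𝓝 (ENNReal.ofReal |g x|)) :=
        ENNReal.tendsto_ofReal hx.abs
      obtain ⟨n, hn⟩ := eventually_atTop.1 (this.eventually_const_lt hcx)
      exact mem_iUnion.2 ⟨n, mem_iInter₂.2 hn⟩
    refine hle.trans ?_
    rw [Monotone.measure_iUnion]
    · exact iSup_le fun n => (measure_mono (biInter_subset_of_mem (le_refl n))).trans (hn n)
    · exact fun n m hnm => biInter_subset_biInter_left fun k hk => le_trans hnm hk
  · filter_upwards [h0, hmono, hlim] with x hx0 hxm hxl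
    have := hxm.ge_of_tendsto hxl n
    rw [abs_of_nonneg (hx0 n), abs_of_nonneg ((hx0 n).trans this)]
    exact this

/-- A measurable function and its rearrangement are equimeasurable. -/
lemma volume_restrict_lt_rearr (c : ℝ≥0∞) :
    volume.restrict (Ioi (0:ℝ)) {u | c < rearr μ f u} =
      μ {x | c < ENNReal.ofReal |f x|} := by
  simp only [lt_rearr_iff]
  exact volume_restrict_Ioi_ofReal_lt _

lemma lintegral_rearr_tsub [SFinite μ] (hf : Measurable f) (r : ℝ≥0∞) :
    ∫⁻ u in Ioi (0:ℝ), (rearr μ f u - r) = ∫⁻ x, (ENNReal.ofReal |f x| - r) ∂μ :=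
  lintegral_tsub_eq_of_equimeasurable _ _ measurable_rearr
    (ENNReal.measurable_ofReal.comp hf.abs) volume_restrict_lt_rearr r

lemma lintegral_rearr_le [SFinite μ] (hf : Measurable f) (t : ℝ) (r : ℝ≥0∞) :
    ∫⁻ u in Ioo 0 t, rearr μ f u ≤
      r * ENNReal.ofReal t + ∫⁻ x, (ENNReal.ofReal |f x| - r) ∂μ := by
  calc ∫⁻ u in Ioo 0 t, rearr μ f u
      ≤ ∫⁻ u in Ioo 0 t, (r + (rearr μ f u - r)) := lintegral_mono fun u => le_add_tsub
    _ = r * ENNReal.ofReal t + ∫⁻ u in Ioo 0 t, (rearr μ f u - r) := by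
        rw [lintegral_add_left measurable_const, lintegral_const, Measure.restrict_apply_univ,
          Real.volume_Ioo, sub_zero]
    _ ≤ _ := by
        rw [← lintegral_rearr_tsub hf]
        gcongr
        exact Ioo_subset_Ioi_self

lemma lintegral_rearr_eq [SFinite μ] (hf : Measurable f) {t : ℝ} (ht : 0 < t) :
    ∫⁻ u in Ioo 0 t, rearr μ f u = rearr μ f t * ENNReal.ofReal t +
      ∫⁻ x, (ENNReal.ofReal |f x| - rearr μ f t) ∂μ := by
  set r := rearr μ f t
  have h1 : ∫⁻ u in Ioi (0:ℝ), (rearr μ f u - r) = ∫⁻ u in Ioo 0 t, (rearr μ f u - r) := by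
    rw [← Ioo_union_Ici_eq_Ioi ht, lintegral_union measurableSet_Ici]
    · have : ∫⁻ u in Ici t, (rearr μ f u - r) = 0 := by
        rw [setLIntegral_congr_fun (g := fun _ => 0) measurableSet_Ici
          fun u hu => tsub_eq_zero_of_le (rearr_antitone hu)]
        simp
      rw [this, add_zero]
    · exact Set.disjoint_left.2 fun u hu hu' => absurd hu.2 (not_lt.2 hu')
  rw [← lintegral_rearr_tsub hf, h1]
  calc ∫⁻ u in Ioo 0 t, rearr μ f u
      = ∫⁻ u in Ioo 0 t, (r + (rearr μ f u - r)) :=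
        setLIntegral_congr_fun measurableSet_Ioo fun u hu =>
          (add_tsub_cancel_of_le (rearr_antitone hu.2.le)).symm
    _ = r * ENNReal.ofReal t + ∫⁻ u in Ioo 0 t, (rearr μ f u - r) := by
        rw [lintegral_add_left measurable_const, lintegral_const, Measure.restrict_apply_univ,
          Real.volume_Ioo, sub_zero]

lemma lintegral_rearr_add_le [SFinite μ] (hf : Measurable f) (hg : Measurable g) {t : ℝ}
    (ht : 0 < t) :
    ∫⁻ u in Ioo 0 t, rearr μ (fun x => f x + g x) u ≤
      (∫⁻ u in Ioo 0 t, rearr μ f u) + ∫⁻ u in Ioo 0 t, rearr μ g u := by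
  set r := rearr μ f t with hr
  set s := rearr μ g t with hs
  rw [lintegral_rearr_eq hf ht, lintegral_rearr_eq hg ht, ← hr, ← hs]
  refine (lintegral_rearr_le (hf.add hg) t (r + s)).trans ?_
  have hmeas : Measurable fun x => ENNReal.ofReal |f x| - r :=
    (ENNReal.measurable_ofReal.comp hf.abs).sub_const r
  have : ∫⁻ x, (ENNReal.ofReal |f x + g x| - (r + s)) ∂μ ≤
      ∫⁻ x, (ENNReal.ofReal |f x| - r) ∂μ + ∫⁻ x, (ENNReal.ofReal |g x| - s) ∂μ := by
    rw [← lintegral_add_left hmeas]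
    refine lintegral_mono fun x => le_trans ?_ add_tsub_add_le_tsub_add_tsub
    gcongr
    rw [← ENNReal.ofReal_add (abs_nonneg _) (abs_nonneg _)]
    exact ENNReal.ofReal_le_ofReal (abs_add_le _ _)
  calc _ ≤ (r + s) * ENNReal.ofReal t + (∫⁻ x, (ENNReal.ofReal |f x| - r) ∂μ +
          ∫⁻ x, (ENNReal.ofReal |g x| - s) ∂μ) := by gcongr; exact this
    _ = _ := by ring

lemma setLIntegral_le_lintegral_rearr [SFinite μ] (hf : Measurable f) {E : Set X} {t : ℝ}
    (ht : 0 < t) (hE : μ E ≤ ENNReal.ofReal t) :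
    ∫⁻ x in E, ENNReal.ofReal |f x| ∂μ ≤ ∫⁻ u in Ioo 0 t, rearr μ f u := by
  rw [lintegral_rearr_eq hf ht]
  set r := rearr μ f t
  calc ∫⁻ x in E, ENNReal.ofReal |f x| ∂μ
      ≤ ∫⁻ x in E, (r + (ENNReal.ofReal |f x| - r)) ∂μ := lintegral_mono fun u => le_add_tsub
    _ = r * μ E + ∫⁻ x in E, (ENNReal.ofReal |f x| - r) ∂μ := by
        rw [lintegral_add_left measurable_const, lintegral_const, Measure.restrict_apply_univ]
    _ ≤ _ := by
        gcongr
        exact Measure.restrict_le_self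

end Rearrangement

section MaximalFunction

variable {X : Type*} [MeasurableSpace X] {μ : Measure X} {f g : X → ℝ}

lemma measurable_maxf : Measurable (maxf μ f) := by
  refine ENNReal.measurable_ofReal.inv.mul (Monotone.measurable fun s t hst => ?_)
  exact lintegral_mono_set (Ioo_subset_Ioo_right hst)

lemma maxf_mono (h : ∀ᵐ x ∂μ, |f x| ≤ |g x|) (t : ℝ) : maxf μ f t ≤ maxf μ g t := by
  unfold maxf
  gcongr with s
  exact rearr_mono h s

lemma maxf_const_mul (a : ℝ) (t : ℝ) :
    maxf μ (fun x => a * f x) t = ENNReal.ofReal |a| * maxf μ f t := by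
  simp only [maxf, rearr_const_mul]
  rw [lintegral_const_mul _ measurable_rearr]
  ring

lemma maxf_add_le [SFinite μ] (hf : Measurable f) (hg : Measurable g) {t : ℝ} (ht : 0 < t) :
    maxf μ (fun x => f x + g x) t ≤ maxf μ f t + maxf μ g t := by
  unfold maxf
  rw [← mul_add]
  gcongr
  exact lintegral_rearr_add_le hf hg ht

lemma maxf_eq_iSup {F : ℕ → X → ℝ} (h0 : ∀ᵐ x ∂μ, ∀ n, 0 ≤ F n x)
    (hmono : ∀ᵐ x ∂μ, Monotone fun n => F n x)
    (hlim : ∀ᵐ x ∂μ, Tendsto (fun n => F n x) atTop (𝓝 (g x))) (t : ℝ) :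
    maxf μ g t = ⨆ n, maxf μ (F n) t := by
  simp only [maxf, rearr_eq_iSup h0 hmono hlim]
  rw [lintegral_iSup (fun n => measurable_rearr), ENNReal.mul_iSup]
  intro n m hnm s
  refine rearr_mono ?_ s
  filter_upwards [h0, hmono] with x hx hxm
  rw [abs_of_nonneg (hx n), abs_of_nonneg (hx m)]
  exact hxm hnm

lemma maxf_le_maxf [SFinite μ] (hf : Measurable f) {s t : ℝ} (hs : 0 < s) (hst : s ≤ t) :
    maxf μ f t ≤ maxf μ f s := by
  have key : ∀ u : ℝ, 0 < u → ∀ r I : ℝ≥0∞,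
      (ENNReal.ofReal u)⁻¹ * (r * ENNReal.ofReal u + I) = r + (ENNReal.ofReal u)⁻¹ * I := by
    intro u hu r I
    rw [mul_add, mul_comm r, ← mul_assoc,
      ENNReal.inv_mul_cancel (by simpa using hu) ofReal_ne_top, one_mul]
  unfold maxf
  rw [lintegral_rearr_eq hf hs, key s hs]
  refine (mul_le_mul_right (lintegral_rearr_le hf t (rearr μ f s)) _).trans ?_
  rw [key t (hs.trans_le hst)]
  gcongr

lemma inv_mul_maxf_one_le_maxf {t : ℝ} (ht : 1 ≤ t) :
    (ENNReal.ofReal t)⁻¹ * maxf μ f 1 ≤ maxf μ f t := by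
  unfold maxf
  simp only [ENNReal.ofReal_one, inv_one, one_mul]
  gcongr

lemma maxf_eq_zero_iff {t : ℝ} (ht : 0 < t) : maxf μ f t = 0 ↔ f =ᵐ[μ] 0 := by
  have hinv : (ENNReal.ofReal t)⁻¹ ≠ 0 := by simp
  unfold maxf
  rw [mul_eq_zero, or_iff_right hinv, lintegral_eq_zero_iff measurable_rearr]
  constructor
  · intro h
    have h0 : ∀ u ∈ Ioo 0 t, rearr μ f u = 0 := by
      intro u hu
      have hpos : volume.restrict (Ioo 0 t) (Ioo 0 u) ≠ 0 := by
        rw [Measure.restrict_apply measurableSet_Ioo,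
          inter_eq_left.2 (Ioo_subset_Ioo_right hu.2.le)]
        simpa using hu.1
      obtain ⟨v, hv, hv0⟩ := (frequently_ae_mem_iff.2 hpos).and_eventually h |>.exists
      exact le_antisymm ((rearr_antitone hv.2.le).trans_eq hv0) zero_le
    have hle : ∀ u ∈ Ioo 0 t, μ {x | 0 < ENNReal.ofReal |f x|} ≤ ENNReal.ofReal u := fun u hu =>
      rearr_le_iff.1 (h0 u hu).le
    have hz : μ {x | 0 < ENNReal.ofReal |f x|} = 0 := by
      refine le_antisymm (ENNReal.le_of_forall_pos_le_add fun ε hε _ => ?_) zero_le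
      have hε' : (0:ℝ) < ε := hε
      have hm : min (t / 2) (ε:ℝ) ∈ Ioo 0 t := ⟨by positivity, by
        have := min_le_left (t / 2) (ε:ℝ); linarith⟩
      refine (hle _ hm).trans ?_
      rw [zero_add, ← ENNReal.ofReal_coe_nnreal]
      exact ENNReal.ofReal_le_ofReal (min_le_right _ _)
    refine measure_mono_null (fun x hx => ?_) hz
    simpa using hx
  · intro h
    have h0 : ∀ u, rearr μ f u = 0 := by
      intro u
      refine le_antisymm (rearr_le_iff.2 (le_of_eq_of_le ?_ zero_le)) zero_le
      refine measure_mono_null (fun x hx => ?_) h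
      simpa using hx
    exact Eventually.of_forall h0

lemma maxf_indicator_le_one (E : Set X) (t : ℝ) :
    maxf μ (E.indicator fun _ => (1:ℝ)) t ≤ 1 := by
  have h1 : ∀ s, rearr μ (E.indicator fun _ => (1:ℝ)) s ≤ 1 := by
    intro s
    refine rearr_le_iff.2 (le_of_eq_of_le ?_ zero_le)
    convert measure_empty (μ := μ)
    ext x
    by_cases hx : x ∈ E <;> simp [hx]
  unfold maxf
  calc _ ≤ (ENNReal.ofReal t)⁻¹ * ∫⁻ s in Ioo 0 t, 1 := by gcongr with s; exact h1 s
    _ ≤ 1 := by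
      simp only [lintegral_const, Measure.restrict_apply_univ, Real.volume_Ioo, sub_zero, one_mul]
      exact ENNReal.inv_mul_le_one _

lemma maxf_indicator_le [SFinite μ] {E : Set X} (hE : MeasurableSet E) (t : ℝ) :
    maxf μ (E.indicator fun _ => (1:ℝ)) t ≤ (ENNReal.ofReal t)⁻¹ * μ E := by
  unfold maxf
  gcongr
  refine (lintegral_rearr_le (measurable_const.indicator hE) t 0).trans ?_
  simp only [zero_mul, zero_add, tsub_zero]
  rw [← lintegral_indicator_one hE]
  refine lintegral_mono fun x => ?_
  by_cases hx : x ∈ E <;> simp [hx]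

end MaximalFunction

section SlowlyVarying

variable {b : ℝ → ℝ} {q : ℝ≥0∞}

lemma IsSlowlyVarying.exists_rpow_mul_le (hb : IsSlowlyVarying b) {ε : ℝ} (hε : 0 < ε) :
    ∃ K : ℝ, 0 < K ∧ ∀ s t, 0 < s → s ≤ t → s ^ ε * b s ≤ K * (t ^ ε * b t) := by
  obtain ⟨bp, hbp, c, C, hc, hC, h⟩ := (hb.2.2 ε hε).1
  refine ⟨C / c, by positivity, fun s t hs hst => ?_⟩
  have ht : t ∈ Ioi (0:ℝ) := hs.trans_le hst
  calc s ^ ε * b s ≤ C * bp s := (h s hs).2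
    _ ≤ C * bp t := by gcongr; exact hbp hs ht hst
    _ = C / c * (c * bp t) := by field_simp
    _ ≤ _ := mul_le_mul_of_nonneg_left (h t ht).1 (by positivity)

lemma IsSlowlyVarying.exists_rpow_neg_mul_le (hb : IsSlowlyVarying b) {ε : ℝ} (hε : 0 < ε) :
    ∃ K : ℝ, 0 < K ∧ ∀ s t, 0 < s → s ≤ t → t ^ (-ε) * b t ≤ K * (s ^ (-ε) * b s) := by
  obtain ⟨bm, hbm, c, C, hc, hC, h⟩ := (hb.2.2 ε hε).2
  refine ⟨C / c, by positivity, fun s t hs hst => ?_⟩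
  have ht : t ∈ Ioi (0:ℝ) := hs.trans_le hst
  calc t ^ (-ε) * b t ≤ C * bm t := (h t ht).2
    _ ≤ C * bm s := by gcongr; exact hbm hs ht hst
    _ = C / c * (c * bm s) := by field_simp
    _ ≤ _ := mul_le_mul_of_nonneg_left (h s hs).1 (by positivity)

lemma ofReal_mul_rpow_rpow {M γ t : ℝ} (hM : 0 ≤ M) (ht : 0 < t) (hq : 1 ≤ q) (hq' : q ≠ ∞) :
    ENNReal.ofReal (M * t ^ (γ - q⁻¹.toReal)) ^ q.toReal =
      ENNReal.ofReal (M ^ q.toReal * t ^ (γ * q.toReal - 1)) := by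
  have h1 := one_le_toReal_of_one_le hq hq'
  rw [ENNReal.ofReal_rpow_of_nonneg (by positivity) (by linarith),
    Real.mul_rpow hM (by positivity), ← Real.rpow_mul ht.le, ENNReal.toReal_inv, sub_mul,
    inv_mul_cancel₀ (by linarith)]

lemma lqNorm_lt_top_of_le_rpow (hq : 1 ≤ q) {S : Set ℝ} (hS : MeasurableSet S)
    (hS0 : S ⊆ Ioi 0) {M γ : ℝ} (hM : 0 ≤ M) (hγ : ∀ t ∈ S, t ^ γ ≤ 1)
    (hint : ∀ r : ℝ, 1 ≤ r → IntegrableOn (fun t : ℝ => t ^ (γ * r - 1)) S)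
    {F : ℝ → ℝ≥0∞} (hF : ∀ t ∈ S, F t ≤ ENNReal.ofReal (M * t ^ (γ - q⁻¹.toReal))) :
    lqNorm q S F < ∞ := by
  refine (lqNorm_mono hS hF).trans_lt ?_
  by_cases hq' : q = ∞
  · subst hq'
    rw [lqNorm_top]
    refine (essSup_le_of_ae_le (ENNReal.ofReal M) ?_).trans_lt ofReal_lt_top
    refine ae_restrict_of_forall_mem hS fun t ht => ENNReal.ofReal_le_ofReal ?_
    simpa using mul_le_of_le_one_right hM (hγ t ht)
  · have h1 := one_le_toReal_of_one_le hq hq'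
    rw [lqNorm_of_ne_top hq']
    refine ENNReal.rpow_lt_top_of_nonneg (by positivity) ?_
    rw [setLIntegral_congr_fun hS fun t ht => ofReal_mul_rpow_rpow hM (hS0 ht) hq hq']
    exact ((hint _ h1).const_mul (M ^ q.toReal)).lintegral_lt_top.ne

lemma IsSlowlyVarying.lqNorm_Ioo_lt_top (hb : IsSlowlyVarying b) (hq : 1 ≤ q) {α : ℝ}
    (hα : 0 < α) :
    lqNorm q (Ioo 0 1) (fun t => ENNReal.ofReal (t ^ (α - q⁻¹.toReal) * b t)) < ∞ := by
  obtain ⟨K, hK, h⟩ := hb.exists_rpow_mul_le (half_pos hα)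
  have hb1 : 0 < b 1 := hb.2.1 1 (mem_Ioi.2 one_pos)
  refine lqNorm_lt_top_of_le_rpow (M := K * b 1) (γ := α / 2) hq measurableSet_Ioo
    (fun t ht => ht.1) (by positivity) (fun t ht => Real.rpow_le_one ht.1.le ht.2.le (by positivity))
    (fun r hr => ?_) fun t ht => ENNReal.ofReal_le_ofReal ?_
  · rw [intervalIntegral.integrableOn_Ioo_rpow_iff one_pos]
    have : 0 < α / 2 * r := by positivity
    linarith
  · have := h t 1 ht.1 ht.2.le
    rw [Real.one_rpow, one_mul] at this
    have e : α - q⁻¹.toReal = (α / 2 - q⁻¹.toReal) + α / 2 := by ring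
    rw [e, Real.rpow_add ht.1, mul_assoc, mul_comm (K * b 1)]
    have := ht.1
    gcongr

lemma IsSlowlyVarying.lqNorm_Ioi_lt_top (hb : IsSlowlyVarying b) (hq : 1 ≤ q) {α : ℝ}
    (hα : α < 0) :
    lqNorm q (Ioi 1) (fun t => ENNReal.ofReal (t ^ (α - q⁻¹.toReal) * b t)) < ∞ := by
  obtain ⟨K, hK, h⟩ := hb.exists_rpow_neg_mul_le (ε := -α / 2) (by linarith)
  have hb1 : 0 < b 1 := hb.2.1 1 (mem_Ioi.2 one_pos)
  refine lqNorm_lt_top_of_le_rpow (M := K * b 1) (γ := α / 2) hq measurableSet_Ioi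
    (fun t ht => one_pos.trans (mem_Ioi.1 ht)) (by positivity)
    (fun t ht => Real.rpow_le_one_of_one_le_of_nonpos (le_of_lt ht) (by linarith))
    (fun r hr => ?_) fun t ht => ENNReal.ofReal_le_ofReal ?_
  · refine integrableOn_Ioi_rpow_of_lt ?_ one_pos
    nlinarith
  · have ht0 : 0 < t := one_pos.trans ht
    have := h 1 t one_pos (le_of_lt ht)
    rw [Real.one_rpow, one_mul] at this
    have e : α - q⁻¹.toReal = (α / 2 - q⁻¹.toReal) + -(-α / 2) := by ring
    rw [e, Real.rpow_add ht0, mul_assoc, mul_comm (K * b 1)]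
    gcongr

lemma IsSlowlyVarying.lqNorm_Ioi_eq_top (hb : IsSlowlyVarying b) (hq : 1 ≤ q) {α : ℝ}
    (hα : 0 < α) :
    lqNorm q (Ioi 1) (fun t => ENNReal.ofReal (t ^ (α - q⁻¹.toReal) * b t)) = ∞ := by
  obtain ⟨K, hK, h⟩ := hb.exists_rpow_mul_le (half_pos hα)
  have hb1 : 0 < b 1 := hb.2.1 1 (mem_Ioi.2 one_pos)
  set M := b 1 / K
  have hM : 0 < M := by positivity
  have hle : lqNorm q (Ioi 1) (fun t => ENNReal.ofReal (M * t ^ (α / 2 - q⁻¹.toReal))) ≤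
      lqNorm q (Ioi 1) (fun t => ENNReal.ofReal (t ^ (α - q⁻¹.toReal) * b t)) := by
    refine lqNorm_mono measurableSet_Ioi fun t ht => ENNReal.ofReal_le_ofReal ?_
    have ht0 : 0 < t := one_pos.trans ht
    have := h 1 t one_pos (le_of_lt ht)
    rw [Real.one_rpow, one_mul] at this
    have e : α - q⁻¹.toReal = (α / 2 - q⁻¹.toReal) + α / 2 := by ring
    rw [e, Real.rpow_add ht0, mul_assoc, mul_comm M]
    gcongr
    rwa [div_le_iff₀' hK]
  refine top_le_iff.1 (le_trans (top_le_iff.2 ?_) hle)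
  by_cases hq' : q = ∞
  · subst hq'
    rw [lqNorm_top]
    by_contra hne
    simp only [inv_top, toReal_zero, sub_zero] at hne
    have hae := ENNReal.ae_le_essSup (μ := volume.restrict (Ioi (1:ℝ)))
      (fun t => ENNReal.ofReal (M * t ^ (α / 2)))
    set L := essSup (fun t => ENNReal.ofReal (M * t ^ (α / 2))) (volume.restrict (Ioi (1:ℝ)))
    have hlim : Tendsto (fun t : ℝ => M * t ^ (α / 2)) atTop atTop :=
      (tendsto_rpow_atTop (by positivity)).const_mul_atTop hM
    obtain ⟨T, hT⟩ := eventually_atTop.1 (hlim.eventually_gt_atTop L.toReal)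
    have hpos : volume.restrict (Ioi (1:ℝ)) (Ioi (max 1 T)) ≠ 0 := by
      rw [Measure.restrict_apply measurableSet_Ioi,
        inter_eq_left.2 (Ioi_subset_Ioi (le_max_left _ _)), Real.volume_Ioi]
      exact top_ne_zero
    obtain ⟨t, ht, hle⟩ := ((frequently_ae_mem_iff.2 hpos).and_eventually hae).exists
    have h1 := hT t ((le_max_right _ _).trans (le_of_lt ht))
    rw [ENNReal.ofReal_le_iff_le_toReal hne] at hle
    linarith
  · have h1 := one_le_toReal_of_one_le hq hq'
    rw [lqNorm_of_ne_top hq', ENNReal.rpow_eq_top_iff_of_pos (by positivity),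
      setLIntegral_congr_fun measurableSet_Ioi fun t ht =>
        ofReal_mul_rpow_rpow hM.le (one_pos.trans ht) hq hq']
    by_contra hne
    have hnn : ∀ᵐ t ∂volume.restrict (Ioi (1:ℝ)),
        0 ≤ M ^ q.toReal * t ^ (α / 2 * q.toReal - 1) :=
      ae_restrict_of_forall_mem measurableSet_Ioi fun t ht => by
        have : (0:ℝ) < t := one_pos.trans ht
        positivity
    have hint : IntegrableOn (fun t : ℝ => M ^ q.toReal * t ^ (α / 2 * q.toReal - 1)) (Ioi 1) :=
      ⟨by fun_prop, (hasFiniteIntegral_iff_ofReal hnn).2 (lt_top_iff_ne_top.2 hne)⟩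
    have := (integrable_const_mul_iff (IsUnit.mk0 _ (by positivity)) _).1 hint
    have := (integrableOn_Ioi_rpow_iff one_pos).1 this
    have : 0 < α / 2 * q.toReal := by positivity
    linarith

lemma inv_mul_ofReal_rpow_mul {t α β : ℝ} (ht : 0 < t) :
    (ENNReal.ofReal t)⁻¹ * ENNReal.ofReal (t ^ (α - β) * b t) =
      ENNReal.ofReal (t ^ (α - 1 - β) * b t) := by
  rw [← ENNReal.ofReal_inv_of_pos ht, ← ENNReal.ofReal_mul (by positivity), ← mul_assoc,
    ← Real.rpow_neg_one, ← Real.rpow_add ht]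
  congr 3
  ring

end SlowlyVarying

section LorentzKaramata

/-- The weight `t ^ (1/p - 1/q) * b t` of the Lorentz–Karamata functional. -/
noncomputable def lkWeight (p q : ℝ≥0∞) (b : ℝ → ℝ) (t : ℝ) : ℝ≥0∞ :=
  ENNReal.ofReal (t ^ (p⁻¹.toReal - q⁻¹.toReal) * b t)

variable {p q : ℝ≥0∞} {b : ℝ → ℝ}

lemma IsSlowlyVarying.measurable_lkWeight (hb : IsSlowlyVarying b) :
    Measurable (lkWeight p q b) :=
  ENNReal.measurable_ofReal.comp ((measurable_id.pow_const _).mul hb.1)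

lemma IsSlowlyVarying.measurable_inv_mul_lkWeight (hb : IsSlowlyVarying b) :
    Measurable fun t => (ENNReal.ofReal t)⁻¹ * lkWeight p q b t :=
  ENNReal.measurable_ofReal.inv.mul hb.measurable_lkWeight

lemma IsSlowlyVarying.measurable_lkWeight_mul_maxf {X : Type*} [MeasurableSpace X]
    {μ : Measure X} {f : X → ℝ} (hb : IsSlowlyVarying b) :
    Measurable fun t => lkWeight p q b t * maxf μ f t :=
  hb.measurable_lkWeight.mul measurable_maxf

lemma IsSlowlyVarying.lkWeight_pos (hb : IsSlowlyVarying b) {t : ℝ} (ht : 0 < t) :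
    0 < lkWeight p q b t :=
  ENNReal.ofReal_pos.2 (mul_pos (Real.rpow_pos_of_pos ht _) (hb.2.1 t ht))

lemma lqNorm_inv_mul_lkWeight :
    lqNorm q (Ioi 1) (fun t => (ENNReal.ofReal t)⁻¹ * lkWeight p q b t) =
      lqNorm q (Ioi 1)
        (fun t => ENNReal.ofReal (t ^ (p⁻¹.toReal - 1 - q⁻¹.toReal) * b t)) := by
  refine le_antisymm ?_ ?_ <;> refine lqNorm_mono measurableSet_Ioi fun t ht => ?_
  · exact (inv_mul_ofReal_rpow_mul (one_pos.trans ht)).le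
  · exact (inv_mul_ofReal_rpow_mul (one_pos.trans ht)).ge

/-- The weight condition for indicators of sets of finite measure to have finite
Lorentz–Karamata norm. -/
def LKAdmissible (p q : ℝ≥0∞) (b : ℝ → ℝ) : Prop :=
  lqNorm q (Ioo 0 1) (lkWeight p q b) < ∞ ∧
    lqNorm q (Ioi 1) (fun t => (ENNReal.ofReal t)⁻¹ * lkWeight p q b t) < ∞

lemma lkAdmissible_iff (hp : 0 < p) (hq : 1 ≤ q) (hb : IsSlowlyVarying b) :
    LKAdmissible p q b ↔
      ((1 < p ∧ p < ∞) ∨ (p = 1 ∧ weightNorm ∞ q b (Ioi 1) < ∞) ∨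
        (p = ∞ ∧ weightNorm ∞ q b (Ioo 0 1) < ∞)) := by
  rw [LKAdmissible, lqNorm_inv_mul_lkWeight]
  have hlow : p ≠ ∞ → lqNorm q (Ioo 0 1) (lkWeight p q b) < ∞ := fun h =>
    hb.lqNorm_Ioo_lt_top hq (ENNReal.toReal_pos (ENNReal.inv_ne_zero.2 h)
      (ENNReal.inv_ne_top.2 hp.ne'))
  rcases lt_trichotomy p 1 with h | rfl | h
  · have h1 : 1 < p⁻¹.toReal := by
      have := (ENNReal.toReal_lt_toReal one_ne_top (ENNReal.inv_ne_top.2 hp.ne')).2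
        (ENNReal.one_lt_inv.2 h)
      simpa using this
    rw [hb.lqNorm_Ioi_eq_top hq (sub_pos.2 h1)]
    simp [h.ne, (h.trans one_lt_top).ne, not_lt.2 h.le]
  · simp [hlow one_ne_top, weightNorm]
  · have h1 : p⁻¹.toReal < 1 := by
      have := (ENNReal.toReal_lt_toReal (ENNReal.inv_ne_top.2 hp.ne') one_ne_top).2
        (ENNReal.inv_lt_one.2 h)
      simpa using this
    have hhigh := hb.lqNorm_Ioi_lt_top hq (sub_neg.2 h1)
    rcases eq_or_ne p ∞ with rfl | hpt
    · rw [and_iff_left hhigh]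
      have hw : lqNorm q (Ioo 0 1) (lkWeight ∞ q b) = weightNorm ∞ q b (Ioo 0 1) := rfl
      simp [hw]
    · rw [and_iff_left hhigh]
      simp [hlow hpt, h, hpt, lt_top_iff_ne_top]

variable {X : Type*} [MeasurableSpace X] {μ : Measure X}

lemma lkMaxNorm_eq (f : X → ℝ) :
    lkMaxNorm μ p q b f = lqNorm q (Ioi 0) (fun t => lkWeight p q b t * maxf μ f t) := rfl

lemma lkMaxNorm_mono {f g : X → ℝ} (h : ∀ᵐ x ∂μ, |f x| ≤ |g x|) :
    lkMaxNorm μ p q b f ≤ lkMaxNorm μ p q b g := by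
  rw [lkMaxNorm_eq, lkMaxNorm_eq]
  exact lqNorm_mono measurableSet_Ioi fun t _ => mul_le_mul_right (maxf_mono h t) _

lemma lkMaxNorm_eq_zero_iff (hq : 1 ≤ q) (hb : IsSlowlyVarying b) (f : X → ℝ) :
    lkMaxNorm μ p q b f = 0 ↔ f =ᵐ[μ] 0 := by
  rw [lkMaxNorm_eq, lqNorm_eq_zero_iff hq hb.measurable_lkWeight_mul_maxf]
  constructor
  · intro h
    have hpos : volume.restrict (Ioi (0:ℝ)) (Ioi 0) ≠ 0 := by simp
    obtain ⟨t, ht, h0⟩ := ((frequently_ae_mem_iff.2 hpos).and_eventually h).exists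
    exact (maxf_eq_zero_iff ht).1 ((mul_eq_zero.1 h0).resolve_left (hb.lkWeight_pos ht).ne')
  · intro h
    refine ae_restrict_of_forall_mem measurableSet_Ioi fun t ht => ?_
    rw [(maxf_eq_zero_iff ht).2 h, mul_zero]

lemma lkMaxNorm_const_mul (hq : 1 ≤ q) (hb : IsSlowlyVarying b) (a : ℝ) (f : X → ℝ) :
    lkMaxNorm μ p q b (fun x => a * f x) = ENNReal.ofReal |a| * lkMaxNorm μ p q b f := by
  rw [lkMaxNorm_eq, lkMaxNorm_eq,
    ← lqNorm_const_mul hq hb.measurable_lkWeight_mul_maxf]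
  simp only [maxf_const_mul, mul_left_comm]

lemma lkMaxNorm_add_le [SFinite μ] (hq : 1 ≤ q) (hb : IsSlowlyVarying b) {f g : X → ℝ}
    (hf : Measurable f) (hg : Measurable g) :
    lkMaxNorm μ p q b (fun x => f x + g x) ≤ lkMaxNorm μ p q b f + lkMaxNorm μ p q b g := by
  simp only [lkMaxNorm_eq]
  refine le_trans (lqNorm_mono measurableSet_Ioi fun t ht => ?_)
    (lqNorm_add_le hq hb.measurable_lkWeight_mul_maxf
      hb.measurable_lkWeight_mul_maxf)
  rw [← mul_add]
  exact mul_le_mul_right (maxf_add_le hf hg ht) _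

lemma lkMaxNorm_eq_iSup (hq : 1 ≤ q) (hb : IsSlowlyVarying b) {F : ℕ → X → ℝ} {g : X → ℝ}
    (h0 : ∀ᵐ x ∂μ, ∀ n, 0 ≤ F n x) (hmono : ∀ᵐ x ∂μ, Monotone fun n => F n x)
    (hlim : ∀ᵐ x ∂μ, Tendsto (fun n => F n x) atTop (𝓝 (g x))) :
    lkMaxNorm μ p q b g = ⨆ n, lkMaxNorm μ p q b (F n) := by
  simp only [lkMaxNorm_eq, maxf_eq_iSup h0 hmono hlim, ENNReal.mul_iSup]
  refine lqNorm_iSup hq (fun n => hb.measurable_lkWeight_mul_maxf) ?_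
  intro n m hnm t
  refine mul_le_mul_right (maxf_mono ?_ t) _
  filter_upwards [h0, hmono] with x hx hxm
  rw [abs_of_nonneg (hx n), abs_of_nonneg (hx m)]
  exact hxm hnm

lemma maxf_mul_lqNorm_le_lkMaxNorm [SFinite μ] (hq : 1 ≤ q) (hb : IsSlowlyVarying b) {f : X → ℝ}
    (hf : Measurable f) (a : ℝ) :
    maxf μ f a * lqNorm q (Ioo 0 a) (lkWeight p q b) ≤ lkMaxNorm μ p q b f := by
  rw [lkMaxNorm_eq, ← lqNorm_const_mul hq hb.measurable_lkWeight]
  refine (lqNorm_mono measurableSet_Ioo fun t ht => ?_).trans (lqNorm_mono_set Ioo_subset_Ioi_self)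
  rw [mul_comm]
  exact mul_le_mul_right (maxf_le_maxf hf ht.1 ht.2.le) _

lemma maxf_one_mul_lqNorm_le_lkMaxNorm (hq : 1 ≤ q) (hb : IsSlowlyVarying b) (f : X → ℝ) :
    maxf μ f 1 * lqNorm q (Ioi 1) (fun t => (ENNReal.ofReal t)⁻¹ * lkWeight p q b t) ≤
      lkMaxNorm μ p q b f := by
  rw [lkMaxNorm_eq, ← lqNorm_const_mul hq
    hb.measurable_inv_mul_lkWeight]
  refine (lqNorm_mono measurableSet_Ioi fun t ht => ?_).trans
    (lqNorm_mono_set (Ioi_subset_Ioi zero_le_one))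
  calc maxf μ f 1 * ((ENNReal.ofReal t)⁻¹ * lkWeight p q b t)
      = lkWeight p q b t * ((ENNReal.ofReal t)⁻¹ * maxf μ f 1) := by ring
    _ ≤ _ := mul_le_mul_right (inv_mul_maxf_one_le_maxf (le_of_lt ht)) _

lemma ae_eq_zero_of_lkMaxNorm_lt_top [SFinite μ] (hq : 1 ≤ q) (hb : IsSlowlyVarying b)
    (hadm : ¬ LKAdmissible p q b) {f : X → ℝ} (hf : Measurable f)
    (hfin : lkMaxNorm μ p q b f < ∞) : f =ᵐ[μ] 0 := by
  rw [← maxf_eq_zero_iff one_pos]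
  by_contra hne
  refine hadm ⟨?_, ?_⟩ <;> refine lt_top_iff_ne_top.2 fun htop => hfin.ne (top_le_iff.1 ?_)
  · have := maxf_mul_lqNorm_le_lkMaxNorm (p := p) (μ := μ) hq hb hf 1
    rwa [htop, ENNReal.mul_top hne] at this
  · have := maxf_one_mul_lqNorm_le_lkMaxNorm (p := p) (μ := μ) hq hb f
    rwa [htop, ENNReal.mul_top hne] at this

lemma lkMaxNorm_indicator_lt_top [SFinite μ] (hq : 1 ≤ q) (hb : IsSlowlyVarying b)
    (hadm : LKAdmissible p q b) {E : Set X} (hE : MeasurableSet E) (hμE : μ E < ∞) :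
    lkMaxNorm μ p q b (E.indicator fun _ => (1:ℝ)) < ∞ := by
  rw [lkMaxNorm_eq, ← Ioo_union_Ici_eq_Ioi one_pos]
  refine (lqNorm_union_le hq).trans_lt (ENNReal.add_lt_top.2 ⟨?_, ?_⟩)
  · refine (lqNorm_mono measurableSet_Ioo fun t _ => ?_).trans_lt hadm.1
    exact mul_le_of_le_one_right' (maxf_indicator_le_one E t)
  · rw [← lqNorm_congr_set Ioi_ae_eq_Ici]
    refine lt_of_le_of_lt ?_ (ENNReal.mul_lt_top hμE hadm.2)
    rw [← lqNorm_const_mul hq hb.measurable_inv_mul_lkWeight]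
    refine lqNorm_mono measurableSet_Ioi fun t _ => ?_
    refine (mul_le_mul_right (maxf_indicator_le hE t) _).trans_eq ?_
    ring

lemma exists_setLIntegral_le_mul_lkMaxNorm [SFinite μ] (hq : 1 ≤ q) (hb : IsSlowlyVarying b)
    {E : Set X} (hμE : μ E < ∞) :
    ∃ C : ℝ≥0∞, C < ∞ ∧ ∀ f : X → ℝ, Measurable f →
      ∫⁻ x in E, ENNReal.ofReal |f x| ∂μ ≤ C * lkMaxNorm μ p q b f := by
  set a : ℝ := (μ E).toReal + 1
  have ha : 0 < a := by positivity
  have hEa : μ E ≤ ENNReal.ofReal a := by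
    rw [← ENNReal.ofReal_toReal hμE.ne]
    exact ENNReal.ofReal_le_ofReal (by simp [a])
  have hne : lqNorm q (Ioo 0 a) (lkWeight p q b) ≠ 0 := by
    rw [Ne, lqNorm_eq_zero_iff hq hb.measurable_lkWeight]
    intro h
    have hpos : volume.restrict (Ioo 0 a) (Ioo 0 a) ≠ 0 := by simpa using ha
    obtain ⟨t, ht, h0⟩ := ((frequently_ae_mem_iff.2 hpos).and_eventually h).exists
    exact (hb.lkWeight_pos ht.1).ne' h0
  set c := min (lqNorm q (Ioo 0 a) (lkWeight p q b)) 1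
  have hc0 : c ≠ 0 := by
    intro h
    rcases min_choice (lqNorm q (Ioo 0 a) (lkWeight p q b)) 1 with h' | h'
    · exact hne (h'.symm.trans h)
    · exact one_ne_zero (h'.symm.trans h)
  have hct : c ≠ ∞ := ((min_le_right _ _).trans_lt one_lt_top).ne
  refine ⟨ENNReal.ofReal a * c⁻¹, ENNReal.mul_lt_top ofReal_lt_top (by simp [pos_iff_ne_zero, hc0]),
    fun f hf => ?_⟩
  calc ∫⁻ x in E, ENNReal.ofReal |f x| ∂μ ≤ ∫⁻ u in Ioo 0 a, rearr μ f u :=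
        setLIntegral_le_lintegral_rearr hf ha hEa
    _ = ENNReal.ofReal a * maxf μ f a := by
        rw [maxf, ← mul_assoc, ENNReal.mul_inv_cancel (by simpa using ha) ofReal_ne_top, one_mul]
    _ = ENNReal.ofReal a * c⁻¹ * (maxf μ f a * c) := by
        rw [mul_comm _ c, mul_assoc, ← mul_assoc c⁻¹, ENNReal.inv_mul_cancel hc0 hct, one_mul]
    _ ≤ ENNReal.ofReal a * c⁻¹ *
          (maxf μ f a * lqNorm q (Ioo 0 a) (lkWeight p q b)) := by
        gcongr
        exact min_le_left _ _
    _ ≤ _ := mul_le_mul_right (maxf_mul_lqNorm_le_lkMaxNorm hq hb hf a) _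

lemma isRIBFN_lkMaxNorm [SFinite μ] (hq : 1 ≤ q) (hb : IsSlowlyVarying b)
    (hadm : LKAdmissible p q b) : IsRIBFN μ (lkMaxNorm μ p q b) where
  abs_eq f _ := by
    refine le_antisymm (lkMaxNorm_mono ?_) (lkMaxNorm_mono ?_) <;> simp
  smul a f _ := lkMaxNorm_const_mul hq hb a f
  eq_zero_iff f _ := lkMaxNorm_eq_zero_iff hq hb f
  add_le _ _ hf hg := lkMaxNorm_add_le hq hb hf hg
  mono _ _ _ _ h := lkMaxNorm_mono h
  fatou _ _ _ _ h0 hmono hlim := lkMaxNorm_eq_iSup hq hb h0 hmono hlim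
  ind_lt_top _ hE hμE := lkMaxNorm_indicator_lt_top hq hb hadm hE hμE
  integral_le _ _ hμE := exists_setLIntegral_le_mul_lkMaxNorm hq hb hμE
  rearr_inv f g _ _ h := by simp only [lkMaxNorm, maxf, h]

lemma lkAdmissible_of_isRIBFN [SigmaFinite μ] (hμ : μ ≠ 0) (hq : 1 ≤ q)
    (hb : IsSlowlyVarying b) (h : IsRIBFN μ (lkMaxNorm μ p q b)) : LKAdmissible p q b := by
  by_contra hadm
  obtain ⟨E, hE, hμE, hpos⟩ : ∃ E, MeasurableSet E ∧ μ E < ∞ ∧ μ E ≠ 0 := by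
    by_contra! hcon
    refine hμ (Measure.measure_univ_eq_zero.1 ?_)
    rw [← iUnion_spanningSets μ]
    exact measure_iUnion_null fun n =>
      hcon _ (measurableSet_spanningSets μ n) (measure_spanningSets_lt_top μ n)
  have hz := ae_eq_zero_of_lkMaxNorm_lt_top hq hb hadm (measurable_const.indicator hE)
    (h.ind_lt_top E hE hμE)
  refine hpos (measure_mono_null (fun x hx => ?_) hz)
  simp [hx]

end LorentzKaramata

/-- Proposition LN: for `q ∈ [1,∞]`, `‖·‖_{(p,q,b)}` is an r.i. Banach
function norm iff one of the three conditions holds; otherwise `L^{(p,q,b)}` is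
trivial. -/
theorem lkMaxNorm_isRIBFN_iff {X : Type*} [MeasurableSpace X] (μ : Measure X)
    [SigmaFinite μ] (hna : IsNonatomic μ) (hμ : μ Set.univ = ∞)
    (p q : ℝ≥0∞) (hp : 0 < p) (hq : 1 ≤ q) (b : ℝ → ℝ) (hb : IsSlowlyVarying b) :
    (IsRIBFN μ (lkMaxNorm μ p q b) ↔
      ((1 < p ∧ p < ∞) ∨
       (p = 1 ∧ weightNorm ∞ q b (Set.Ioi 1) < ∞) ∨
       (p = ∞ ∧ weightNorm ∞ q b (Set.Ioo 0 1) < ∞))) ∧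
    (¬((1 < p ∧ p < ∞) ∨
       (p = 1 ∧ weightNorm ∞ q b (Set.Ioi 1) < ∞) ∨
       (p = ∞ ∧ weightNorm ∞ q b (Set.Ioo 0 1) < ∞)) →
      ∀ f : X → ℝ, Measurable f → lkMaxNorm μ p q b f < ∞ → f =ᵐ[μ] 0) := by
  rw [← lkAdmissible_iff hp hq hb]
  refine ⟨⟨lkAdmissible_of_isRIBFN (fun h => ?_) hq hb, isRIBFN_lkMaxNorm hq hb⟩,
    fun hadm f hf hfin => ae_eq_zero_of_lkMaxNorm_lt_top hq hb hadm hf hfin⟩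
  simp [h] at hμ
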